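/- Let R be a commutative σ-elementary ring with unity and nonzero Jacobson radical, with σ(R) finite. Then R is isomorphic to the ring of matrices {[[a,b,c],[0,a,0],[0,0,a]] : a,b,c ∈ F_q} for some finite field F_q; equivalently, R ≅ F_q ⊕ J with dim_{F_q} J = 2 and J² = 0. Consequently σ(R) = q + 1. -/

import Mathlib

/-- A cover of a ring by proper subrings (subrings need not contain `1`). -/
def IsSubringCover {R : Type*} [Ring R] (C : Finset (NonUnitalSubring R)) : Prop :=
  (∀ S ∈ C, S ≠ ⊤) ∧ ∀ r : R, ∃ S ∈ C, r ∈ S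

/-- The covering number of a ring: the least size of a cover by proper subrings,
`⊤` if no (finite) cover exists. -/
noncomputable def ringSigma (R : Type*) [Ring R] : ℕ∞ :=
  sInf {n : ℕ∞ | ∃ C : Finset (NonUnitalSubring R), IsSubringCover C ∧ (C.card : ℕ∞) = n}


theorem sigma_le_of_cover {R : Type*} [Ring R] (C : Finset (NonUnitalSubring R))
    (h : IsSubringCover C) : ringSigma R ≤ (C.card : ℕ∞) :=
  sInf_le ⟨C, h, rfl⟩

theorem exists_min_cover {R : Type*} [Ring R]
    (hcov : ∃ C : Finset (NonUnitalSubring R), IsSubringCover C) :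
    ∃ C : Finset (NonUnitalSubring R), IsSubringCover C ∧ (C.card : ℕ∞) = ringSigma R := by
  obtain ⟨C, hC⟩ := hcov
  have : ringSigma R ∈
      {n : ℕ∞ | ∃ C : Finset (NonUnitalSubring R), IsSubringCover C ∧ (C.card : ℕ∞) = n} :=
    csInf_mem ⟨_, C, hC, rfl⟩
  exact this

theorem sigma_le_of_surjective {R T : Type*} [Ring R] [Ring T] (g : R →+* T)
    (hg : Function.Surjective g) : ringSigma R ≤ ringSigma T := by
  classical
  refine le_sInf ?_
  rintro n ⟨C, hC, rfl⟩
  have h : IsSubringCover (C.image (fun S => S.comap g)) := by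
    refine ⟨?_, ?_⟩
    · intro S hS
      obtain ⟨S', hS', rfl⟩ := Finset.mem_image.mp hS
      intro htop
      apply hC.1 S' hS'
      rw [eq_top_iff]
      intro t _
      obtain ⟨r, rfl⟩ := hg t
      have : r ∈ S'.comap g := by rw [htop]; trivial
      exact this
    · intro r
      obtain ⟨S, hS, hr⟩ := hC.2 (g r)
      exact ⟨S.comap g, Finset.mem_image_of_mem _ hS, hr⟩
  exact (sigma_le_of_cover _ h).trans (by exact_mod_cast Finset.card_image_le)

theorem sigma_quot_le {R : Type*} [CommRing R] (C : Finset (NonUnitalSubring R))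
    (hC : IsSubringCover C) (I : Ideal R) (hI : ∀ S ∈ C, ∀ x ∈ I, x ∈ S) :
    ringSigma (R ⧸ I) ≤ (C.card : ℕ∞) := by
  classical
  have h : IsSubringCover (C.image (fun S => S.map (Ideal.Quotient.mk I))) := by
    refine ⟨?_, ?_⟩
    · intro S hS
      obtain ⟨S', hS', rfl⟩ := Finset.mem_image.mp hS
      intro htop
      apply hC.1 S' hS'
      rw [eq_top_iff]
      intro t _
      have : Ideal.Quotient.mk I t ∈ S'.map (Ideal.Quotient.mk I) := by rw [htop]; trivial
      obtain ⟨s, hs, hst⟩ := NonUnitalSubring.mem_map.mp this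
      have h2 : t - s ∈ I := Ideal.Quotient.eq.mp hst.symm
      have := S'.add_mem (hI S' hS' _ h2) hs
      simpa using this
    · intro r
      obtain ⟨r, rfl⟩ := Ideal.Quotient.mk_surjective r
      obtain ⟨S, hS, hr⟩ := hC.2 r
      exact ⟨_, Finset.mem_image_of_mem _ hS, NonUnitalSubring.mem_map.mpr ⟨r, hr, rfl⟩⟩
  exact (sigma_le_of_cover _ h).trans (by exact_mod_cast Finset.card_image_le)

/-- The largest ideal contained in a subring. -/
def coreIdeal {R : Type*} [CommRing R] (S : NonUnitalSubring R) : Ideal R where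
  carrier := {x | ∀ r, x * r ∈ S}
  add_mem' := by
    intro a b ha hb r
    rw [add_mul]; exact S.add_mem (ha r) (hb r)
  zero_mem' := by intro r; rw [zero_mul]; exact S.zero_mem
  smul_mem' := by
    intro c x hx r
    have := hx (c * r)
    rw [smul_eq_mul]
    convert this using 1; ring

theorem coreIdeal_finiteIndex {R : Type*} [CommRing R] (S : NonUnitalSubring R)
    (h : S.toAddSubgroup.FiniteIndex) : (coreIdeal S).toAddSubgroup.FiniteIndex := by
  have : Finite (R ⧸ S.toAddSubgroup) := AddSubgroup.finite_quotient_of_finiteIndex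
  let D : AddSubgroup R := S.toAddSubgroup ⊓
    ⨅ t : R ⧸ S.toAddSubgroup, S.toAddSubgroup.comap (AddMonoidHom.mulRight t.out)
  have h1 : (⨅ t : R ⧸ S.toAddSubgroup,
      S.toAddSubgroup.comap (AddMonoidHom.mulRight t.out)).FiniteIndex :=
    AddSubgroup.finiteIndex_iInf (fun t => ⟨by
      rw [AddSubgroup.index_comap]
      exact fun h0 => h.index_ne_zero (Nat.eq_zero_of_zero_dvd
        (h0 ▸ AddSubgroup.relIndex_dvd_index_of_normal _ _))⟩)
  have hD : D.FiniteIndex := inferInstance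
  refine AddSubgroup.finiteIndex_of_le (H := D) ?_
  rintro x ⟨hx1, hx2⟩ r
  have hx2 := (AddSubgroup.mem_iInf.mp hx2) (QuotientAddGroup.mk r)
  have h3 : x * (QuotientAddGroup.mk r : R ⧸ S.toAddSubgroup).out ∈ S := hx2
  have h4 : -(QuotientAddGroup.mk r : R ⧸ S.toAddSubgroup).out + r ∈ S :=
    (QuotientAddGroup.eq (s := S.toAddSubgroup)).mp (Quotient.out_eq' _)
  have := S.add_mem h3 (S.mul_mem hx1 h4)
  convert this using 1; ring

open Pointwise in
theorem finite_of_elem {R : Type*} [CommRing R]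
    (hcov : ∃ C : Finset (NonUnitalSubring R), IsSubringCover C)
    (helem : ∀ I : Ideal R, I ≠ ⊥ → ringSigma R < ringSigma (R ⧸ I)) : Finite R := by
  classical
  obtain ⟨C, hC, hcard⟩ := exists_min_cover hcov
  have hun : ⋃ S ∈ C, ((0 : R) +ᵥ (S.toAddSubgroup : Set R)) = Set.univ := by
    rw [Set.eq_univ_iff_forall]
    intro r
    obtain ⟨S, hS, hr⟩ := hC.2 r
    simp only [Set.mem_iUnion]
    exact ⟨S, hS, by simpa using hr⟩
  have hun2 := AddSubgroup.leftCoset_cover_filter_FiniteIndex hun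
  set C' := C.filter (fun S => S.toAddSubgroup.FiniteIndex) with hC'
  have hcov' : IsSubringCover C' := by
    refine ⟨fun S hS => hC.1 S (Finset.mem_filter.mp hS).1, fun r => ?_⟩
    have : r ∈ (Set.univ : Set R) := trivial
    rw [← hun2] at this
    simp only [Set.mem_iUnion] at this
    obtain ⟨S, hS, hr⟩ := this
    exact ⟨S, hS, by simpa using hr⟩
  let L : Ideal R := ⨅ S : C', coreIdeal S.1
  have hL : L = ⊥ := by
    by_contra hne
    have h1 := helem L hne
    have h2 : ringSigma (R ⧸ L) ≤ C'.card := by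
      refine sigma_quot_le C' hcov' L ?_
      intro S hS x hx
      have := (Submodule.mem_iInf _).mp hx ⟨S, hS⟩ 1
      simpa using this
    have h3 : (C'.card : ℕ∞) ≤ C.card := by exact_mod_cast Finset.card_filter_le _ _
    rw [hcard] at h3
    exact absurd (h1.trans_le (h2.trans h3)) (lt_irrefl _)
  have hfi : (⨅ S : C', (coreIdeal S.1).toAddSubgroup).FiniteIndex :=
    AddSubgroup.finiteIndex_iInf
      (fun S => coreIdeal_finiteIndex S.1 (Finset.mem_filter.mp S.2).2)
  have hbot : (⨅ S : C', (coreIdeal S.1).toAddSubgroup) = ⊥ := by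
    rw [eq_bot_iff]
    intro x hx
    have : x ∈ L := by
      rw [Submodule.mem_iInf]
      intro S
      exact AddSubgroup.mem_iInf.mp hx S
    rw [hL] at this
    exact this
  rw [hbot] at hfi
  have : Finite (R ⧸ (⊥ : AddSubgroup R)) := AddSubgroup.finite_quotient_of_finiteIndex
  exact Finite.of_equiv _ (QuotientAddGroup.quotientBot (G := R)).toEquiv

/-- The lines `x.snd ∈ L` in the trivial square-zero extension. -/
def lineSubring (F : Type*) [Field F] (c d : F) :
    NonUnitalSubring (TrivSqZeroExt F (F × F)) where
  carrier := {x | c * x.snd.1 = d * x.snd.2}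
  add_mem' := by
    intro a b ha hb
    simp only [Set.mem_ofPred_eq, TrivSqZeroExt.snd_add, Prod.fst_add, Prod.snd_add] at *
    linear_combination ha + hb
  zero_mem' := by simp
  neg_mem' := by
    intro a ha
    simp only [Set.mem_ofPred_eq, TrivSqZeroExt.snd_neg, Prod.fst_neg, Prod.snd_neg] at *
    linear_combination -ha
  mul_mem' := by
    intro a b ha hb
    simp only [Set.mem_ofPred_eq, TrivSqZeroExt.snd_mul, Prod.fst_add, Prod.snd_add,
      Prod.smul_fst, Prod.smul_snd, smul_eq_mul, MulOpposite.smul_eq_mul_unop,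
      MulOpposite.unop_op] at *
    linear_combination a.fst * hb + b.fst * ha

theorem mem_lineSubring (F : Type*) [Field F] (c d : F) (x : TrivSqZeroExt F (F × F)) :
    x ∈ lineSubring F c d ↔ c * x.snd.1 = d * x.snd.2 := Iff.rfl

theorem sigma_tsz_le (F : Type*) [Field F] [Fintype F] :
    ringSigma (TrivSqZeroExt F (F × F)) ≤ (Fintype.card F : ℕ∞) + 1 := by
  classical
  let g : Option F → NonUnitalSubring (TrivSqZeroExt F (F × F)) := fun o =>
    match o with
    | none => lineSubring F 1 0
    | some a => lineSubring F a 1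
  have h : IsSubringCover (Finset.univ.image g) := by
    refine ⟨?_, ?_⟩
    · intro S hS
      obtain ⟨o, -, rfl⟩ := Finset.mem_image.mp hS
      intro htop
      cases o with
      | none =>
        have : (TrivSqZeroExt.inr (1, 0) : TrivSqZeroExt F (F × F)) ∈ lineSubring F 1 0 := by
          change _ ∈ g none
          rw [htop]; trivial
        rw [mem_lineSubring] at this
        simp at this
      | some a =>
        have : (TrivSqZeroExt.inr (0, 1) : TrivSqZeroExt F (F × F)) ∈ lineSubring F a 1 := by
          change _ ∈ g (some a)
          rw [htop]; trivial
        rw [mem_lineSubring] at this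
        simp at this
    · intro x
      by_cases hx : x.snd.1 = 0
      · refine ⟨g none, Finset.mem_image_of_mem _ (Finset.mem_univ _), ?_⟩
        change x ∈ lineSubring F 1 0
        rw [mem_lineSubring]; simp [hx]
      · refine ⟨g (some (x.snd.2 / x.snd.1)), Finset.mem_image_of_mem _ (Finset.mem_univ _), ?_⟩
        change x ∈ lineSubring F _ 1
        rw [mem_lineSubring]; field_simp
  refine (sigma_le_of_cover _ h).trans ?_
  have : (Finset.univ.image g).card ≤ Fintype.card F + 1 :=
    Finset.card_image_le.trans (by simp)
  exact_mod_cast this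

theorem charP_of_natCast_zero {A : Type*} [CommRing A] [Nontrivial A] {p : ℕ} (hp : p.Prime)
    (h : (p : A) = 0) : CharP A p := by
  obtain ⟨c, hc⟩ := CharP.exists A
  have hd : c ∣ p := (CharP.cast_eq_zero_iff A c p).mp h
  rcases (Nat.dvd_prime hp).mp hd with h1 | h1
  · exact absurd h1 (CharP.char_ne_one A c)
  · rwa [← h1]

theorem struct_lemma {A K : Type*} [CommRing A] [Field K] [Fintype K] (ρ : A →+* K)
    (hρ : Function.Surjective ρ) (hsq : ∀ x y, ρ x = 0 → ρ y = 0 → x * y = 0)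
    (p : ℕ) (hp : p.Prime) (hpA : (p : A) = 0) (u v : A) (hu : ρ u = 0) (hv : ρ v = 0)
    (hspan : ∀ x, ρ x = 0 → ∃ a b, x = a * u + b * v)
    (hind : ∀ a b, a * u + b * v = 0 → ρ a = 0 ∧ ρ b = 0) :
    Nonempty (A ≃+* TrivSqZeroExt K (K × K)) := by
  have : Nontrivial A := ρ.domain_nontrivial
  have hcA : CharP A p := charP_of_natCast_zero hp hpA
  have hcK : CharP K p := charP_of_natCast_zero hp (by rw [← map_natCast ρ, hpA, map_zero])
  have : Fact p.Prime := ⟨hp⟩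
  obtain ⟨n, -, hn⟩ := FiniteField.card K p
  have hq2 : 2 ≤ p ^ (n : ℕ) := hn ▸ Fintype.one_lt_card
  have key : ∀ x y, ρ x = ρ y → x ^ p ^ (n : ℕ) = y ^ p ^ (n : ℕ) := by
    intro x y hxy
    rw [← sub_eq_zero, ← sub_pow_char_pow]
    have : ρ (x - y) = 0 := by rw [map_sub, hxy, sub_self]
    have h2 : (x - y) ^ 2 = 0 := by rw [pow_two]; exact hsq _ _ this this
    exact pow_eq_zero_of_le hq2 h2
  let l : K → A := Function.surjInv hρ
  have hl : ∀ k, ρ (l k) = k := Function.surjInv_eq hρ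
  let s : K →+* A :=
    { toFun := fun k => l k ^ p ^ (n : ℕ)
      map_one' := by rw [key (l 1) 1 (by rw [hl, map_one]), one_pow]
      map_zero' := by
        rw [key (l 0) 0 (by rw [hl, map_zero]), zero_pow (by omega)]
      map_add' := fun a b => by
        rw [← add_pow_char_pow]
        exact key _ _ (by rw [map_add, hl, hl, hl])
      map_mul' := fun a b => by
        rw [← mul_pow]
        exact key _ _ (by rw [map_mul, hl, hl, hl]) }
  have hs : ∀ k, ρ (s k) = k := by
    intro k
    change ρ (l k ^ p ^ (n : ℕ)) = k
    rw [map_pow, hl, ← hn, FiniteField.pow_card]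
  have huu := hsq u u hu hu
  have huv := hsq u v hu hv
  have hvv := hsq v v hv hv
  let Ψ : TrivSqZeroExt K (K × K) →+* A :=
    { toFun := fun x => s x.fst + s x.snd.1 * u + s x.snd.2 * v
      map_one' := by simp
      map_zero' := by simp
      map_add' := fun x y => by simp; ring
      map_mul' := fun x y => by
        simp only [TrivSqZeroExt.fst_mul, TrivSqZeroExt.snd_mul, Prod.fst_add, Prod.snd_add,
          Prod.smul_fst, Prod.smul_snd, smul_eq_mul, MulOpposite.smul_eq_mul_unop,
          MulOpposite.unop_op, map_add, map_mul]
        linear_combination (-(s x.snd.1 * s y.snd.1)) * huu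
          - (s x.snd.1 * s y.snd.2 + s x.snd.2 * s y.snd.1) * huv
          - (s x.snd.2 * s y.snd.2) * hvv }
  have hΨ : ∀ x, Ψ x = s x.fst + s x.snd.1 * u + s x.snd.2 * v := fun _ => rfl
  have hbij : Function.Bijective Ψ := by
    constructor
    · rw [injective_iff_map_eq_zero]
      intro x hx
      rw [hΨ] at hx
      have h1 : x.fst = 0 := by
        have := congrArg ρ hx
        simpa [hs, hu, hv] using this
      rw [h1, map_zero, zero_add] at hx
      obtain ⟨h2, h3⟩ := hind _ _ hx
      rw [hs] at h2 h3
      exact TrivSqZeroExt.ext h1 (Prod.ext h2 h3)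
    · intro x
      have h0 : ρ (x - s (ρ x)) = 0 := by rw [map_sub, hs, sub_self]
      obtain ⟨a, b, hab⟩ := hspan _ h0
      refine ⟨TrivSqZeroExt.inl (ρ x) + TrivSqZeroExt.inr (ρ a, ρ b), ?_⟩
      rw [hΨ]
      have ha : (s (ρ a) - a) * u = 0 := hsq _ _ (by rw [map_sub, hs, sub_self]) hu
      have hb : (s (ρ b) - b) * v = 0 := hsq _ _ (by rw [map_sub, hs, sub_self]) hv
      simp only [TrivSqZeroExt.fst_add, TrivSqZeroExt.snd_add, TrivSqZeroExt.fst_inl,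
        TrivSqZeroExt.fst_inr, TrivSqZeroExt.snd_inl, TrivSqZeroExt.snd_inr, add_zero, zero_add]
      linear_combination ha + hb - hab
  exact ⟨(RingEquiv.ofBijective Ψ hbij).symm⟩

theorem exists_small_field (K : Type*) [Field K] [Finite K] :
    ∃ (F : Type) (_ : Field F) (_ : Fintype F), Nonempty (K ≃+* F) := by
  have : Fintype K := Fintype.ofFinite K
  obtain ⟨p, hc, n, hp, hn⟩ := FiniteField.card' K
  have : Fact p.Prime := ⟨hp⟩
  let alg : Algebra (ZMod p) K := ZMod.algebra K p
  have h : Nat.card K = p ^ (n : ℕ) := by rw [Nat.card_eq_fintype_card, hn]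
  exact ⟨GaloisField p n, inferInstance, Fintype.ofFinite _,
    ⟨(GaloisField.algEquivGaloisField p n h).toRingEquiv⟩⟩

theorem nilpotent_mem_jacobson {R : Type*} [CommRing R] (x : R) (h : IsNilpotent x) :
    x ∈ Ideal.jacobson (⊥ : Ideal R) :=
  Ideal.radical_le_jacobson (mem_nilradical.mpr h)

theorem exists_pow_sub_mem {R : Type*} [CommRing R] [Finite R] (y : R) (N : ℕ) :
    ∃ m, N ≤ m ∧ y - y ^ m ∈ Ideal.jacobson (⊥ : Ideal R) := by
  obtain ⟨a, b, hab, hne⟩ : ∃ a b : ℕ, a < b ∧ y ^ a = y ^ b := by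
    obtain ⟨a, b, hne, h⟩ := Finite.exists_ne_map_eq_of_infinite (fun n : ℕ => y ^ n)
    rcases lt_or_gt_of_ne hne with h1 | h1
    · exact ⟨a, b, h1, h⟩
    · exact ⟨b, a, h1, h.symm⟩
  obtain ⟨d, rfl⟩ := Nat.exists_eq_add_of_lt hab
  have h1 : y - y ^ (d + 1 + 1) ∈ Ideal.jacobson (⊥ : Ideal R) := by
    apply nilpotent_mem_jacobson
    refine ⟨a + 1, ?_⟩
    have : y - y ^ (d + 1 + 1) = y * (1 - y ^ (d + 1)) := by ring
    rw [this, mul_pow]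
    have h2 : y ^ a * (1 - y ^ (d + 1)) = 0 := by
      have : y ^ (a + d + 1) = y ^ a * y ^ (d + 1) := by ring
      rw [this] at hne
      linear_combination hne
    calc y ^ (a + 1) * (1 - y ^ (d + 1)) ^ (a + 1)
        = y ^ a * (1 - y ^ (d + 1)) * (y * (1 - y ^ (d + 1)) ^ a) := by ring
      _ = 0 := by rw [h2, zero_mul]
  refine ⟨(d + 1) * N + 1, by nlinarith, ?_⟩
  induction N with
  | zero => simp
  | succ N ih =>
    have : y - y ^ ((d + 1) * (N + 1) + 1) =
        (y - y ^ ((d + 1) * N + 1)) + y ^ ((d + 1) * N) * (y - y ^ (d + 1 + 1)) := by ring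
    rw [this]
    exact Ideal.add_mem _ ih (Ideal.mul_mem_left _ _ h1)

theorem exists_frob {R : Type*} [CommRing R] [Finite R] (p : ℕ) (hp : p.Prime) :
    ∃ k, 1 ≤ k ∧ ∀ x : R, x ^ p ^ k - x ∈ Ideal.jacobson (⊥ : Ideal R) ⊔ Ideal.span {(p : R)} := by
  set B := Ideal.jacobson (⊥ : Ideal R) ⊔ Ideal.span {(p : R)} with hB
  by_cases hBt : B = ⊤
  · exact ⟨1, le_rfl, fun x => by rw [hBt]; trivial⟩
  have : Nontrivial (R ⧸ B) := Ideal.Quotient.nontrivial_iff.mpr hBt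
  have hp0 : ((p : ℕ) : R ⧸ B) = 0 := by
    rw [← map_natCast (Ideal.Quotient.mk B), Ideal.Quotient.eq_zero_iff_mem]
    exact Ideal.mem_sup_right (Ideal.mem_span_singleton_self _)
  have : CharP (R ⧸ B) p := charP_of_natCast_zero hp hp0
  have : Fact p.Prime := ⟨hp⟩
  have : Finite (R ⧸ B) := Finite.of_surjective _ Ideal.Quotient.mk_surjective
  obtain ⟨a, b, hab, he⟩ : ∃ a b : ℕ, a < b ∧
      (fun x : R ⧸ B => x ^ p ^ a) = (fun x : R ⧸ B => x ^ p ^ b) := by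
    obtain ⟨a, b, hne, h⟩ := Finite.exists_ne_map_eq_of_infinite
      (fun n : ℕ => (fun x : R ⧸ B => x ^ p ^ n))
    rcases lt_or_gt_of_ne hne with h1 | h1
    · exact ⟨a, b, h1, h⟩
    · exact ⟨b, a, h1, h.symm⟩
  obtain ⟨d, rfl⟩ := Nat.exists_eq_add_of_lt hab
  refine ⟨d + 1, by omega, fun x => ?_⟩
  set y := x ^ p ^ (d + 1) - x with hy
  have h1 : y ^ p ^ a ∈ B := by
    rw [← Ideal.Quotient.eq_zero_iff_mem, map_pow, hy, map_sub, sub_pow_char_pow, map_pow,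
      ← pow_mul, ← pow_add, sub_eq_zero]
    have := congrFun he (Ideal.Quotient.mk B x)
    rw [show d + 1 + a = a + d + 1 by ring]
    exact this.symm
  obtain ⟨m, hm, hym⟩ := exists_pow_sub_mem y (p ^ a)
  have h2 : y ^ m ∈ B := by
    obtain ⟨c, rfl⟩ := Nat.exists_eq_add_of_le hm
    rw [pow_add]
    exact Ideal.mul_mem_right _ _ h1
  have h3 : y - y ^ m ∈ B := Ideal.mem_sup_left hym
  have := Ideal.add_mem _ h3 h2
  simpa using this

theorem add_pow_sq_zero {R : Type*} [CommRing R] (x j : R) (hj : j * j = 0) (n : ℕ) :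
    (x + j) ^ n = x ^ n + n * x ^ (n - 1) * j := by
  induction n with
  | zero => simp
  | succ n ih =>
    rw [pow_succ, ih]
    cases n with
    | zero => simp
    | succ n =>
      push_cast
      linear_combination ((n + 1 : R) * x ^ n) * hj

theorem exists_phi {R : Type*} [CommRing R] [Finite R]
    (hJ2 : ∀ x ∈ Ideal.jacobson (⊥ : Ideal R), ∀ y ∈ Ideal.jacobson (⊥ : Ideal R), x * y = 0)
    (s : Finset ℕ) (hs : ∀ p ∈ s, p.Prime) :
    ∃ φ : R → R,
      (∀ x, φ x - x ∈ Ideal.jacobson (⊥ : Ideal R) ⊔ Ideal.span {((∏ p ∈ s, p : ℕ) : R)}) ∧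
      (∀ x, ∀ j ∈ Ideal.jacobson (⊥ : Ideal R),
        ∃ a ∈ Ideal.jacobson (⊥ : Ideal R) ⊔ Ideal.span {((∏ p ∈ s, p : ℕ) : R)},
          φ (x + j) - φ x = a * j) ∧
      (∀ (M : NonUnitalSubring R), ∀ x ∈ M, φ x ∈ M) := by
  classical
  set J := Ideal.jacobson (⊥ : Ideal R) with hJ
  induction s using Finset.induction_on with
  | empty =>
    refine ⟨fun _ => 0, ?_, ?_, ?_⟩
    · intro x
      have : J ⊔ Ideal.span {((∏ p ∈ (∅ : Finset ℕ), p : ℕ) : R)} = ⊤ := by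
        simp
      rw [this]; trivial
    · intro x j _
      exact ⟨0, Ideal.zero_mem _, by simp⟩
    · intro M x _
      exact M.zero_mem
  | insert p s hps ih =>
    obtain ⟨ψ, h1, h2, h3⟩ := ih (fun q hq => hs q (Finset.mem_insert_of_mem hq))
    have hp : p.Prime := hs p (Finset.mem_insert_self _ _)
    obtain ⟨k, hk, hfr⟩ := exists_frob (R := R) p hp
    rw [Finset.prod_insert hps]
    set n := ∏ p ∈ s, p with hn
    have hcop : Nat.Coprime p n := by
      apply Nat.Coprime.prod_right
      intro q hq
      refine (Nat.coprime_primes hp (hs q (Finset.mem_insert_of_mem hq))).mpr ?_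
      rintro rfl
      exact hps hq
    obtain ⟨a, b, hab⟩ : ∃ a b : ℤ, a * p + b * n = 1 := by
      have := Nat.isCoprime_iff_coprime.mpr hcop
      obtain ⟨a, b, h⟩ := this
      exact ⟨a, b, h⟩
    have habR : (a : R) * p + b * n = 1 := by exact_mod_cast congrArg (Int.cast : ℤ → R) hab
    have hcomb : ∀ x ∈ J ⊔ Ideal.span {(p : R)}, ∀ y ∈ J ⊔ Ideal.span {(n : R)},
        (b * n : R) * x + (a * p) * y ∈ J ⊔ Ideal.span {((p * n : ℕ) : R)} := by
      intro x hx y hy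
      obtain ⟨j1, hj1, z1, hz1, rfl⟩ := Submodule.mem_sup.mp hx
      obtain ⟨j2, hj2, z2, hz2, rfl⟩ := Submodule.mem_sup.mp hy
      obtain ⟨w1, rfl⟩ := Ideal.mem_span_singleton'.mp hz1
      obtain ⟨w2, rfl⟩ := Ideal.mem_span_singleton'.mp hz2
      have : (b * n : R) * (j1 + w1 * p) + (a * p) * (j2 + w2 * n) =
        (b * n * j1 + a * p * j2) + (b * w1 + a * w2) * ((p * n : ℕ) : R) := by
        push_cast; ring
      rw [this]
      exact Submodule.add_mem_sup (J.add_mem (J.mul_mem_left _ hj1) (J.mul_mem_left _ hj2))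
        (Ideal.mem_span_singleton'.mpr ⟨_, rfl⟩)
    refine ⟨fun x => (b * n : R) * x ^ p ^ k + (a * p) * ψ x, ?_, ?_, ?_⟩
    · intro x
      have := hcomb _ (hfr x) _ (h1 x)
      convert this using 1
      linear_combination x * habR
    · intro x j hj
      obtain ⟨c, hc, hcj⟩ := h2 x j hj
      have hd : ((p ^ k : ℕ) : R) * x ^ (p ^ k - 1) ∈ J ⊔ Ideal.span {(p : R)} := by
        apply Ideal.mem_sup_right
        apply Ideal.mul_mem_right
        rw [Ideal.mem_span_singleton]
        push_cast
        exact dvd_pow_self _ (by omega)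
      refine ⟨_, hcomb _ hd _ hc, ?_⟩
      beta_reduce
      rw [add_pow_sq_zero x j (hJ2 j hj j hj)]
      linear_combination (a * p : R) * hcj
    · intro M x hx
      have e1 : (b * n : R) * x ^ p ^ k = (b * n : ℤ) • x ^ p ^ k := by
        rw [zsmul_eq_mul]; push_cast; ring
      have e2 : (a * p : R) * ψ x = (a * p : ℤ) • ψ x := by
        rw [zsmul_eq_mul]; push_cast; ring
      have hpow : ∀ m : ℕ, x ^ (m + 1) ∈ M := by
        intro m
        induction m with
        | zero => simpa using hx
        | succ m ih => rw [pow_succ]; exact M.mul_mem ih hx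
      have hpos : 0 < p ^ k := pow_pos hp.pos k
      have hx2 : x ^ p ^ k ∈ M := by
        have := hpow (p ^ k - 1)
        rwa [Nat.sub_add_cancel hpos] at this
      change (b * n : R) * x ^ p ^ k + (a * p) * ψ x ∈ M
      rw [e1, e2]
      exact M.add_mem (zsmul_mem hx2 _) (zsmul_mem (h3 M x hx) _)

theorem coatom_add {R : Type*} [CommRing R] (M : NonUnitalSubring R) (hM : IsCoatom M)
    (I : Ideal R) (hI : ¬ ∀ x ∈ I, x ∈ M) (x : R) : ∃ m ∈ M, x - m ∈ I := by
  let N : NonUnitalSubring R :=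
    { carrier := {x | ∃ m ∈ M, x - m ∈ I}
      add_mem' := by
        rintro a b ⟨m, hm, ha⟩ ⟨m', hm', hb⟩
        refine ⟨m + m', M.add_mem hm hm', ?_⟩
        have := I.add_mem ha hb
        convert this using 1; ring
      zero_mem' := ⟨0, M.zero_mem, by simp⟩
      neg_mem' := by
        rintro a ⟨m, hm, ha⟩
        refine ⟨-m, M.neg_mem hm, ?_⟩
        have := I.neg_mem ha
        convert this using 1; ring
      mul_mem' := by
        rintro a b ⟨m, hm, ha⟩ ⟨m', hm', hb⟩
        refine ⟨m * m', M.mul_mem hm hm', ?_⟩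
        have := I.add_mem (I.mul_mem_left b ha) (I.mul_mem_left m hb)
        convert this using 1; ring }
  have hlt : M < N := by
    refine lt_of_le_of_ne (fun m hm => ⟨m, hm, by simp⟩) ?_
    intro h
    apply hI
    intro y hy
    rw [h]
    exact ⟨0, M.zero_mem, by simpa using hy⟩
  have := hM.2 N hlt
  have hx : x ∈ N := by rw [this]; trivial
  exact hx

theorem sq_le_coatom {R : Type*} [CommRing R] (J : Ideal R) (hnil : IsNilpotent J)
    (M : NonUnitalSubring R) (hM : IsCoatom M) : ∀ x ∈ J ^ 2, x ∈ M := by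
  by_contra hcon
  have hadd := coatom_add M hM (J ^ 2) hcon
  have key : ∀ k : ℕ, ∀ x ∈ J ^ 2, ∃ m ∈ M, x - m ∈ J ^ (k + 2) := by
    intro k
    induction k with
    | zero => intro x hx; exact ⟨0, M.zero_mem, by simpa using hx⟩
    | succ k ih =>
      have hgood : ∀ a ∈ J, ∃ m ∈ M, a - m ∈ J ^ (k + 2) := by
        intro a _
        obtain ⟨m, hm, h1⟩ := hadd a
        obtain ⟨m', hm', h2⟩ := ih _ h1
        exact ⟨m + m', M.add_mem hm hm', by convert h2 using 1; ring⟩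
      intro x hx
      rw [pow_two] at hx
      refine Submodule.mul_induction_on hx ?_ ?_
      · intro a ha b hb
        obtain ⟨m, hm, h1⟩ := hgood a ha
        obtain ⟨m', hm', h2⟩ := hgood b hb
        have hmJ : m ∈ J := by
          have := J.sub_mem ha (Ideal.pow_le_self (by omega) h1)
          simpa using this
        refine ⟨m * m', M.mul_mem hm hm', ?_⟩
        have e : a * b - m * m' = (a - m) * b + (b - m') * m := by ring
        rw [e, show k + 1 + 2 = k + 2 + 1 by ring, pow_succ]
        exact Ideal.add_mem _ (Ideal.mul_mem_mul h1 hb) (Ideal.mul_mem_mul h2 hmJ)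
      · rintro a b ⟨m, hm, h1⟩ ⟨m', hm', h2⟩
        refine ⟨m + m', M.add_mem hm hm', ?_⟩
        have := Ideal.add_mem _ h1 h2
        convert this using 1; ring
  apply hcon
  intro x hx
  obtain ⟨n, hn⟩ := hnil
  obtain ⟨m, hm, h⟩ := key n x hx
  have : x - m ∈ J ^ n := Ideal.pow_le_pow_right (by omega) h
  rw [hn] at this
  have : x - m = 0 := this
  rw [sub_eq_zero.mp this]; exact hm

theorem cover_counting {R : Type*} [CommRing R] [Finite R] (P J : Ideal R) (hP : P.IsMaximal)
    (T : Finset (Ideal R)) (hT1 : ∀ K ∈ T, P * J ≤ K) (hT2 : ∀ K ∈ T, K < J)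
    (hcov : ∀ j ∈ J, ∃ K ∈ T, j ∈ K) : Nat.card (R ⧸ P) + 1 ≤ T.card := by
  classical
  have hne : (T.powerset.filter (fun T' => ∀ j ∈ J, ∃ K ∈ T', j ∈ K)).Nonempty :=
    ⟨T, by simpa using hcov⟩
  obtain ⟨T', hT', hmin⟩ := Finset.exists_min_image _ Finset.card hne
  simp only [Finset.mem_filter, Finset.mem_powerset] at hT' hmin
  obtain ⟨hsub, hcov'⟩ := hT'
  obtain ⟨K1, hK1, -⟩ := hcov' 0 J.zero_mem
  have hx : ∃ x ∈ J, ∀ K ∈ T'.erase K1, x ∉ K := by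
    by_contra! hcon
    have := hmin (T'.erase K1) ⟨(Finset.erase_subset _ _).trans hsub, hcon⟩
    have h2 := Finset.card_erase_lt_of_mem hK1
    omega
  obtain ⟨x, hxJ, hx⟩ := hx
  have hxK1 : x ∈ K1 := by
    obtain ⟨K, hK, hxK⟩ := hcov' x hxJ
    by_cases h : K = K1
    · rwa [← h]
    · exact absurd hxK (hx K (Finset.mem_erase.mpr ⟨h, hK⟩))
  obtain ⟨y, hyJ, hyK1⟩ := SetLike.exists_of_lt (hT2 K1 (hsub hK1))
  let r : R ⧸ P → R := fun a => Function.surjInv Ideal.Quotient.mk_surjective a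
  have hr : ∀ a, Ideal.Quotient.mk P (r a) = a := Function.surjInv_eq _
  have hg : ∀ a : R ⧸ P, ∃ K ∈ T'.erase K1, y + r a * x ∈ K := by
    intro a
    obtain ⟨K, hK, h⟩ := hcov' (y + r a * x) (J.add_mem hyJ (J.mul_mem_left _ hxJ))
    refine ⟨K, Finset.mem_erase.mpr ⟨?_, hK⟩, h⟩
    rintro rfl
    apply hyK1
    have := K.sub_mem h (K.mul_mem_left (r a) hxK1)
    simpa using this
  choose g hg1 hg2 using hg
  have hinj : Function.Injective (fun a => (⟨g a, hg1 a⟩ : {K // K ∈ T'.erase K1})) := by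
    intro a b hab
    have hab : g a = g b := congrArg Subtype.val hab
    by_contra hne
    have hnP : r a - r b ∉ P := by
      intro h
      apply hne
      rw [← hr a, ← hr b]
      exact Ideal.Quotient.eq.mpr h
    obtain ⟨c, i, hi, hci⟩ := hP.exists_inv hnP
    have h1 := hg2 a
    rw [hab] at h1
    have h2 := (g b).sub_mem h1 (hg2 b)
    have h3 : i * x ∈ g b :=
      hT1 (g b) (hsub (Finset.mem_of_mem_erase (hg1 b))) (Ideal.mul_mem_mul hi hxJ)
    have h4 := (g b).add_mem ((g b).mul_mem_left c h2) h3
    apply hx (g b) (hg1 b)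
    convert h4 using 1
    linear_combination (-x) * hci
  have h1 := Nat.card_le_card_of_injective _ hinj
  rw [Nat.card_eq_fintype_card (α := {K // K ∈ T'.erase K1}), Fintype.card_coe] at h1
  have h2 := Finset.card_erase_lt_of_mem hK1
  have h3 := Finset.card_le_card hsub
  omega

theorem exists_crt {R : Type*} [CommRing R] [Finite R] (P : Ideal R) (hP : P.IsMaximal) :
    ∃ c : R, 1 - c ∈ P ∧ ∀ Q : Ideal R, Q.IsMaximal → Q ≠ P → c ∈ Q := by
  classical
  have hfin : ∀ T : Finset (Ideal R), (∀ Q ∈ T, Q.IsMaximal ∧ Q ≠ P) →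
      ∃ c : R, 1 - c ∈ P ∧ ∀ Q ∈ T, c ∈ Q := by
    intro T
    induction T using Finset.induction_on with
    | empty => intro _; exact ⟨1, by simp, by simp⟩
    | insert Q T hQT ih =>
      intro h
      obtain ⟨c, hc, hcT⟩ := ih (fun Q' hQ' => h Q' (Finset.mem_insert_of_mem hQ'))
      obtain ⟨hQ, hQP⟩ := h Q (Finset.mem_insert_self _ _)
      have hnle : ¬ Q ≤ P := fun hle => hQP (hQ.eq_of_le hP.ne_top hle)
      obtain ⟨t, htQ, htP⟩ := SetLike.not_le_iff_exists.mp hnle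
      obtain ⟨y, i, hi, hyi⟩ := hP.exists_inv htP
      refine ⟨c * (y * t), ?_, ?_⟩
      · have := P.add_mem hc (P.mul_mem_left c hi)
        convert this using 1
        linear_combination (-c) * hyi
      · intro Q' hQ'
        rcases Finset.mem_insert.mp hQ' with rfl | h'
        · exact Ideal.mul_mem_left _ _ (Ideal.mul_mem_left _ _ htQ)
        · exact Ideal.mul_mem_right _ _ (hcT Q' h')
  have : Finite (Ideal R) := Finite.of_injective (fun I : Ideal R => (I : Set R)) SetLike.coe_injective
  obtain ⟨c, hc, hcT⟩ := hfin (Set.toFinite {Q : Ideal R | Q.IsMaximal ∧ Q ≠ P}).toFinset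
    (by intro Q hQ; simpa using hQ)
  exact ⟨c, hc, fun Q h1 h2 => hcT Q (by simpa using ⟨h1, h2⟩)⟩

theorem covBy_span {R : Type*} [CommRing R] {K J : Ideal R} (hK : K ⋖ J) {x : R} (hx : x ∈ J)
    (hxK : x ∉ K) {j : R} (hj : j ∈ J) : ∃ a, j - a * x ∈ K := by
  have hle : K ⊔ Ideal.span {x} ≤ J := sup_le hK.le ((Ideal.span_singleton_le_iff_mem J).mpr hx)
  rcases hK.eq_or_eq (le_sup_left : K ≤ K ⊔ Ideal.span {x}) hle with h | h
  · exfalso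
    apply hxK
    rw [← h]
    exact Ideal.mem_sup_right (Ideal.mem_span_singleton_self x)
  · rw [← h] at hj
    obtain ⟨k, hk, z, hz, rfl⟩ := Submodule.mem_sup.mp hj
    obtain ⟨a, rfl⟩ := Ideal.mem_span_singleton'.mp hz
    exact ⟨a, by simpa using hk⟩

theorem covBy_exists_max {R : Type*} [CommRing R] {K J : Ideal R} (hK : K ⋖ J) :
    ∃ P : Ideal R, P.IsMaximal ∧ P * J ≤ K := by
  obtain ⟨x, hxJ, hxK⟩ := SetLike.exists_of_lt hK.lt
  let P : Ideal R := Submodule.comap (LinearMap.mulRight R x) K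
  have hPm : ∀ r, r ∈ P ↔ r * x ∈ K := fun r => Iff.rfl
  refine ⟨P, ?_, ?_⟩
  · rw [Ideal.isMaximal_iff]
    refine ⟨by rw [hPm]; simpa using hxK, ?_⟩
    intro Q r hPQ hrP hrQ
    rw [hPm] at hrP
    obtain ⟨a, ha⟩ := covBy_span hK (J.mul_mem_left r hxJ) hrP hxJ
    have : 1 - a * r ∈ P := by
      rw [hPm]; convert ha using 1; ring
    have := Q.add_mem (hPQ this) (Q.mul_mem_left a hrQ)
    simpa using this
  · rw [Ideal.mul_le]
    intro r hr j hj
    obtain ⟨a, ha⟩ := covBy_span hK hxJ hxK hj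
    have := K.add_mem (K.mul_mem_left r ha) (K.mul_mem_left a ((hPm r).mp hr))
    convert this using 1; ring

theorem select_lemma {R : Type*} [CommRing R] [Finite R] (J : Ideal R)
    (T : Finset (Ideal R)) (hT : ∀ K ∈ T, K ⋖ J) (hcov : ∀ j ∈ J, ∃ K ∈ T, j ∈ K) :
    ∃ P : Ideal R, P.IsMaximal ∧ ∃ T' ⊆ T, (∀ K ∈ T', P * J ≤ K) ∧
      ∀ j ∈ J, ∃ K ∈ T', j ∈ K := by
  classical
  by_contra! hcon
  have h1 : ∀ K : Ideal R, ∃ P : Ideal R, K ∈ T → P.IsMaximal ∧ P * J ≤ K := by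
    intro K
    by_cases h : K ∈ T
    · obtain ⟨P, hP⟩ := covBy_exists_max (hT K h)
      exact ⟨P, fun _ => hP⟩
    · exact ⟨⊤, fun h' => absurd h' h⟩
  choose Pf hPf using h1
  have h2 : ∀ P : Ideal R, ∃ v ∈ J, P.IsMaximal → ∀ K ∈ T, Pf K = P → v ∉ K := by
    intro P
    by_cases hP : P.IsMaximal
    · obtain ⟨j, hj, h⟩ := hcon P hP (T.filter (fun K => Pf K = P)) (Finset.filter_subset _ _)
        (by
          intro K hK
          obtain ⟨hK1, hK2⟩ := Finset.mem_filter.mp hK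
          rw [← hK2]
          exact (hPf K hK1).2)
      exact ⟨j, hj, fun _ K hK hKP => h K (Finset.mem_filter.mpr ⟨hK, hKP⟩)⟩
    · exact ⟨0, J.zero_mem, fun h => absurd h hP⟩
  choose v hvJ hv using h2
  have h3 : ∀ P : Ideal R, ∃ c : R, P.IsMaximal →
      1 - c ∈ P ∧ ∀ Q : Ideal R, Q.IsMaximal → Q ≠ P → c ∈ Q := by
    intro P
    by_cases hP : P.IsMaximal
    · obtain ⟨c, hc⟩ := exists_crt P hP
      exact ⟨c, fun _ => hc⟩
    · exact ⟨0, fun h => absurd h hP⟩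
  choose c hc using h3
  have hmax : ∀ Q ∈ T.image Pf, Q.IsMaximal := by
    intro Q hQ
    obtain ⟨K, hK, rfl⟩ := Finset.mem_image.mp hQ
    exact (hPf K hK).1
  obtain ⟨K, hK, hmem⟩ := hcov (∑ Q ∈ T.image Pf, c Q * v Q)
    (J.sum_mem (fun Q _ => J.mul_mem_left _ (hvJ Q)))
  have hPK := hPf K hK
  have hin : Pf K ∈ T.image Pf := Finset.mem_image_of_mem _ hK
  rw [← Finset.add_sum_erase _ _ hin] at hmem
  have h4 : ∑ Q ∈ (T.image Pf).erase (Pf K), c Q * v Q ∈ K := by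
    apply K.sum_mem
    intro Q hQ
    obtain ⟨hne, hQT⟩ := Finset.mem_erase.mp hQ
    exact hPK.2 (Ideal.mul_mem_mul ((hc Q (hmax Q hQT)).2 _ hPK.1 hne.symm) (hvJ Q))
  have h5 : (1 - c (Pf K)) * v (Pf K) ∈ K :=
    hPK.2 (Ideal.mul_mem_mul (hc _ hPK.1).1 (hvJ _))
  apply hv (Pf K) hPK.1 K hK rfl
  have h6 := K.add_mem (K.sub_mem hmem h4) h5
  convert h6 using 1; ring

theorem main_build {R : Type*} [CommRing R] [Finite R] (J : Ideal R)
    (hJ : J = Ideal.jacobson (⊥ : Ideal R)) (P : Ideal R) (hP : P.IsMaximal)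
    (K1 K2 : Ideal R) (hne : K1 ≠ K2) (hK1 : K1 ⋖ J) (hK2 : K2 ⋖ J)
    (hPK1 : P * J ≤ K1) (hPK2 : P * J ≤ K2) (s : Finset ℕ) (hs : ∀ p ∈ s, p.Prime)
    (hn1 : ((∏ p ∈ s, p : ℕ) : R) ∈ K1) (hn2 : ((∏ p ∈ s, p : ℕ) : R) ∈ K2) :
    ∃ (I : Ideal R) (F : Type) (_ : Field F) (_ : Fintype F),
      Nonempty ((R ⧸ I) ≃+* TrivSqZeroExt F (F × F)) ∧ Fintype.card F = Nat.card (R ⧸ P) := by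
  classical
  obtain ⟨c, hc, hcQ⟩ := exists_crt P hP
  have hmemJ : ∀ x : R, (∀ Q : Ideal R, Q.IsMaximal → x ∈ Q) → x ∈ J := by
    intro x hx
    rw [hJ, Ideal.jacobson, Ideal.mem_sInf]
    intro Q hQ
    exact hx Q hQ.2
  have hJP : J ≤ P := by
    rw [hJ, Ideal.jacobson]
    exact sInf_le ⟨bot_le, hP⟩
  have hcP : ∀ x ∈ P, c * x ∈ J := by
    intro x hx
    apply hmemJ
    intro Q hQ
    by_cases h : Q = P
    · rw [h]; exact P.mul_mem_left _ hx
    · exact Q.mul_mem_right _ (hcQ Q hQ h)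
  let I : Ideal R := P ⊓ Submodule.comap (LinearMap.mulLeft R c) (K1 ⊓ K2)
  have hI : ∀ x, x ∈ I ↔ x ∈ P ∧ c * x ∈ K1 ∧ c * x ∈ K2 := fun x => Iff.rfl
  have hIP : I ≤ P := inf_le_left
  obtain ⟨u, huK2, huK1⟩ : ∃ u ∈ K2, u ∉ K1 := by
    apply SetLike.not_le_iff_exists.mp
    intro hle
    rcases hK2.eq_or_eq hle hK1.le with h | h
    · exact hne h
    · exact hK1.lt.ne h
  obtain ⟨v, hvK1, hvK2⟩ : ∃ v ∈ K1, v ∉ K2 := by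
    apply SetLike.not_le_iff_exists.mp
    intro hle
    rcases hK1.eq_or_eq hle hK2.le with h | h
    · exact hne h.symm
    · exact hK2.lt.ne h
  have huJ : u ∈ J := hK2.le huK2
  have hvJ : v ∈ J := hK1.le hvK1
  letI : Field (R ⧸ P) := Ideal.Quotient.field P
  have hfinq : Finite (R ⧸ P) := Finite.of_surjective _ Ideal.Quotient.mk_surjective
  obtain ⟨F, hF, hFf, ⟨e⟩⟩ := exists_small_field (R ⧸ P)
  let ρ : R ⧸ I →+* F := (e : R ⧸ P →+* F).comp (Ideal.Quotient.factor hIP)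
  have hρ0 : ∀ x : R, ρ (Ideal.Quotient.mk I x) = 0 ↔ x ∈ P := by
    intro x
    change e (Ideal.Quotient.mk P x) = 0 ↔ x ∈ P
    rw [map_eq_zero_iff e e.injective, Ideal.Quotient.eq_zero_iff_mem]
  have hρs : Function.Surjective ρ := by
    intro f
    obtain ⟨x, hx⟩ := Ideal.Quotient.mk_surjective (e.symm f)
    refine ⟨Ideal.Quotient.mk I x, ?_⟩
    change e (Ideal.Quotient.mk P x) = f
    rw [hx, e.apply_symm_apply]
  -- the prime
  obtain ⟨p, hpc, -, hp, -⟩ := FiniteField.card' F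
  have hnP : ∀ m : ℕ, (m : R) ∈ P ↔ p ∣ m := by
    intro m
    rw [← hρ0, map_natCast, map_natCast, CharP.cast_eq_zero_iff F p]
  have hps : p ∈ s := by
    have : p ∣ ∏ q ∈ s, q := (hnP _).mp (hJP (hK1.le hn1))
    obtain ⟨q, hq, hpq⟩ := (Prime.dvd_finset_prod_iff hp.prime _).mp this
    rwa [(Nat.prime_dvd_prime_iff_eq hp (hs q hq)).mp hpq]
  have hpP : (p : R) ∈ P := (hnP p).mpr dvd_rfl
  rw [← Finset.mul_prod_erase s _ hps, Nat.cast_mul] at hn1 hn2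
  set n' : ℕ := ∏ q ∈ s.erase p, q with hn'
  have hn'P : (n' : R) ∉ P := by
    rw [hnP]
    intro h
    obtain ⟨q, hq, hpq⟩ := (Prime.dvd_finset_prod_iff hp.prime _).mp h
    obtain ⟨hqp, hqs⟩ := Finset.mem_erase.mp hq
    exact hqp ((Nat.prime_dvd_prime_iff_eq hp (hs q hqs)).mp hpq).symm
  obtain ⟨y, i, hi, hyi⟩ := hP.exists_inv hn'P
  have hpK : ∀ K : Ideal R, P * J ≤ K → (p : R) * n' ∈ K → c * p ∈ K := by
    intro K hPK hn
    have h1 : i * (c * p) ∈ K := hPK (Ideal.mul_mem_mul hi (hcP _ hpP))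
    have h2 := K.add_mem (K.mul_mem_left (y * c) hn) h1
    convert h2 using 1
    linear_combination (-(c * p)) * hyi
  have hpI : (p : R) ∈ I := (hI _).mpr ⟨hpP, hpK K1 hPK1 hn1, hpK K2 hPK2 hn2⟩
  have hcj : ∀ K : Ideal R, P * J ≤ K → ∀ j ∈ J, c * j - j ∈ K := by
    intro K hPK j hj
    have := K.neg_mem (hPK (Ideal.mul_mem_mul hc hj))
    convert this using 1; ring
  have hcancel : ∀ K : Ideal R, P * J ≤ K → ∀ w ∈ J, w ∉ K → ∀ a, a * w ∈ K → a ∈ P := by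
    intro K hPK w hw hwK a ha
    by_contra haP
    obtain ⟨y, i, hi, hyi⟩ := hP.exists_inv haP
    apply hwK
    have := K.add_mem (K.mul_mem_left y ha) (hPK (Ideal.mul_mem_mul hi hw))
    convert this using 1
    linear_combination (-w) * hyi
  have hiso : Nonempty ((R ⧸ I) ≃+* TrivSqZeroExt F (F × F)) := by
    refine struct_lemma ρ hρs ?_ p hp ?_ (Ideal.Quotient.mk I u) (Ideal.Quotient.mk I v)
      ((hρ0 u).mpr (hJP huJ)) ((hρ0 v).mpr (hJP hvJ)) ?_ ?_
    · intro x y hx hy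
      obtain ⟨x, rfl⟩ := Ideal.Quotient.mk_surjective x
      obtain ⟨y, rfl⟩ := Ideal.Quotient.mk_surjective y
      rw [hρ0] at hx hy
      rw [← map_mul, Ideal.Quotient.eq_zero_iff_mem, hI]
      have h : c * (x * y) ∈ P * J := by
        have := Ideal.mul_mem_mul hy (hcP x hx)
        convert this using 1; ring
      exact ⟨P.mul_mem_right _ hx, hPK1 h, hPK2 h⟩
    · rw [← map_natCast (Ideal.Quotient.mk I), Ideal.Quotient.eq_zero_iff_mem]
      exact hpI
    · intro x hx
      obtain ⟨x, rfl⟩ := Ideal.Quotient.mk_surjective x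
      rw [hρ0] at hx
      obtain ⟨a, ha⟩ := covBy_span hK1 huJ huK1 (hcP x hx)
      obtain ⟨b, hb⟩ := covBy_span hK2 hvJ hvK2 (hcP x hx)
      refine ⟨Ideal.Quotient.mk I a, Ideal.Quotient.mk I b, ?_⟩
      rw [← map_mul, ← map_mul, ← map_add, Ideal.Quotient.eq, hI]
      have hw : a * u + b * v ∈ J := J.add_mem (J.mul_mem_left _ huJ) (J.mul_mem_left _ hvJ)
      refine ⟨P.sub_mem hx (hJP hw), ?_, ?_⟩
      · have := K1.sub_mem (K1.sub_mem ha (K1.mul_mem_left b hvK1)) (hcj K1 hPK1 _ hw)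
        convert this using 1; ring
      · have := K2.sub_mem (K2.sub_mem hb (K2.mul_mem_left a huK2)) (hcj K2 hPK2 _ hw)
        convert this using 1; ring
    · intro a b hab
      obtain ⟨a, rfl⟩ := Ideal.Quotient.mk_surjective a
      obtain ⟨b, rfl⟩ := Ideal.Quotient.mk_surjective b
      rw [← map_mul, ← map_mul, ← map_add, Ideal.Quotient.eq_zero_iff_mem, hI] at hab
      obtain ⟨-, h1, h2⟩ := hab
      have hw : a * u + b * v ∈ J := J.add_mem (J.mul_mem_left _ huJ) (J.mul_mem_left _ hvJ)
      rw [hρ0, hρ0]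
      constructor
      · apply hcancel K1 hPK1 u huJ huK1
        have := K1.sub_mem (K1.sub_mem h1 (hcj K1 hPK1 _ hw)) (K1.mul_mem_left b hvK1)
        convert this using 1; ring
      · apply hcancel K2 hPK2 v hvJ hvK2
        have := K2.sub_mem (K2.sub_mem h2 (hcj K2 hPK2 _ hw)) (K2.mul_mem_left a huK2)
        convert this using 1; ring
  refine ⟨I, F, hF, hFf, hiso, ?_⟩
  rw [← Nat.card_eq_fintype_card]
  exact (Nat.card_congr e.toEquiv).symm

theorem prod_primes_mem_jacobson {R : Type*} [CommRing R] [Finite R] :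
    ((∏ p ∈ (Nat.card R).primeFactors, p : ℕ) : R) ∈ Ideal.jacobson (⊥ : Ideal R) := by
  apply nilpotent_mem_jacobson
  set m := Nat.card R with hm
  have hm0 : m ≠ 0 := Nat.card_pos.ne'
  have hdvd : m ∣ (∏ p ∈ m.primeFactors, p) ^ m := by
    rw [← Finset.prod_pow]
    conv_lhs => rw [← Nat.prod_factorization_pow_eq_self hm0]
    apply Finset.prod_dvd_prod_of_dvd
    intro p _
    exact pow_dvd_pow _ (Nat.factorization_lt p hm0).le
  refine ⟨m, ?_⟩
  have h0 : (m : R) = 0 := by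
    have : Fintype R := Fintype.ofFinite R
    rw [hm, Nat.card_eq_fintype_card]
    exact Nat.cast_card_eq_zero R
  obtain ⟨t, ht⟩ := hdvd
  rw [← Nat.cast_pow, ht, Nat.cast_mul, h0, zero_mul]

theorem exists_coatom_cover {R : Type*} [CommRing R] [Finite R] (C : Finset (NonUnitalSubring R))
    (hC : IsSubringCover C) : ∃ C' : Finset (NonUnitalSubring R), IsSubringCover C' ∧
      C'.card ≤ C.card ∧ ∀ M ∈ C', IsCoatom M := by
  classical
  have : Finite (NonUnitalSubring R) :=
    Finite.of_injective (fun I : NonUnitalSubring R => (I : Set R)) SetLike.coe_injective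
  have h : ∀ S : NonUnitalSubring R, ∃ M, S ∈ C → IsCoatom M ∧ S ≤ M := by
    intro S
    by_cases hS : S ∈ C
    · rcases eq_top_or_exists_le_coatom S with h | ⟨M, hM, hle⟩
      · exact absurd h (hC.1 S hS)
      · exact ⟨M, fun _ => ⟨hM, hle⟩⟩
    · exact ⟨S, fun h => absurd h hS⟩
  choose f hf using h
  refine ⟨C.image f, ⟨?_, ?_⟩, Finset.card_image_le, ?_⟩
  · intro S hS
    obtain ⟨S, hS', rfl⟩ := Finset.mem_image.mp hS
    exact (hf S hS').1.1
  · intro r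
    obtain ⟨S, hS, hr⟩ := hC.2 r
    exact ⟨f S, Finset.mem_image_of_mem _ hS, (hf S hS).2 hr⟩
  · intro S hS
    obtain ⟨S, hS', rfl⟩ := Finset.mem_image.mp hS
    exact (hf S hS').1

/-- A commutative σ-elementary unital ring with nonzero Jacobson radical and finite
covering number is isomorphic to `F_q ⊕ J` with `dim_{F_q} J = 2` and `J² = 0`
(equivalently, the `3 × 3` matrix ring of the paper), i.e. to the trivial square-zero
extension `TrivSqZeroExt F (F × F)` for some finite field `F`; consequently
`σ(R) = q + 1`. -/
theorem stmt_16 {R : Type*} [CommRing R]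
    (hcov : ∃ C : Finset (NonUnitalSubring R), IsSubringCover C)
    (helem : ∀ I : Ideal R, I ≠ ⊥ → ringSigma R < ringSigma (R ⧸ I))
    (hJ : Ideal.jacobson (⊥ : Ideal R) ≠ ⊥)
    (hfin : ringSigma R ≠ ⊤) :
    ∃ (F : Type) (_ : Field F) (_ : Fintype F),
      Nonempty (R ≃+* TrivSqZeroExt F (F × F)) ∧
        ringSigma R = (Fintype.card F : ℕ∞) + 1 := by
  classical
  have hfinR : Finite R := finite_of_elem hcov helem
  obtain ⟨C0, hC0, hcard0⟩ := exists_min_cover hcov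
  obtain ⟨C, hC, hCC0, hcoat⟩ := exists_coatom_cover C0 hC0
  have hcard : (C.card : ℕ∞) ≤ ringSigma R := by
    rw [← hcard0]; exact_mod_cast hCC0
  -- any ideal inside all members of a small cover vanishes
  have hvanish : ∀ I : Ideal R, ringSigma (R ⧸ I) ≤ ringSigma R → I = ⊥ := by
    intro I h
    by_contra hne
    exact absurd ((helem I hne).trans_le h) (lt_irrefl _)
  set J := Ideal.jacobson (⊥ : Ideal R) with hJdef
  have hJsq : J ^ 2 = ⊥ := by
    apply hvanish
    refine (sigma_quot_le C hC (J ^ 2) ?_).trans hcard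
    intro S hS
    exact sq_le_coatom J IsArtinianRing.isNilpotent_jacobson_bot S (hcoat S hS)
  have hJ2 : ∀ x ∈ J, ∀ y ∈ J, x * y = 0 := by
    intro x hx y hy
    have : x * y ∈ J ^ 2 := by rw [pow_two]; exact Ideal.mul_mem_mul hx hy
    rw [hJsq] at this
    exact this
  set s := (Nat.card R).primeFactors with hs
  have hsp : ∀ p ∈ s, p.Prime := fun p hp => Nat.prime_of_mem_primeFactors hp
  have hnJ : ((∏ p ∈ s, p : ℕ) : R) ∈ J := prod_primes_mem_jacobson
  obtain ⟨φ, hφ1, hφ2, hφ3⟩ := exists_phi hJ2 s hsp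
  have hsup : J ⊔ Ideal.span {((∏ p ∈ s, p : ℕ) : R)} = J :=
    sup_eq_left.mpr ((Ideal.span_singleton_le_iff_mem J).mpr hnJ)
  rw [← hJdef, hsup] at hφ1
  rw [← hJdef, hsup] at hφ2
  let CA := C.filter (fun M => ∀ x ∈ J, x ∈ M)
  let CB := C.filter (fun M => ¬ ∀ x ∈ J, x ∈ M)
  -- an element not covered by the subrings containing the radical
  obtain ⟨x, hx⟩ : ∃ x : R, ∀ M ∈ CA, x ∉ M := by
    by_contra! hcon
    apply hJ
    apply hvanish
    have hcovA : IsSubringCover CA := ⟨fun S hS => hC.1 S (Finset.mem_filter.mp hS).1, hcon⟩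
    refine (sigma_quot_le CA hcovA J (fun S hS => (Finset.mem_filter.mp hS).2)).trans ?_
    refine le_trans ?_ hcard
    exact_mod_cast Finset.card_filter_le _ _
  have hCB : ∀ M ∈ CB, ∀ r : R, ∃ m ∈ M, r - m ∈ J := by
    intro M hM
    obtain ⟨hMC, hMJ⟩ := Finset.mem_filter.mp hM
    exact coatom_add M (hcoat M hMC) J hMJ
  let kI : NonUnitalSubring R → Ideal R := fun M => coreIdeal M ⊓ J
  have hkI : ∀ M ∈ CB, ∀ j ∈ J, j ∈ M → j ∈ kI M := by
    intro M hM j hj hjM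
    refine ⟨?_, hj⟩
    intro r
    obtain ⟨m, hm, hrm⟩ := hCB M hM r
    have h0 := hJ2 j hj _ hrm
    have : j * r = j * m := by linear_combination h0
    rw [this]
    exact M.mul_mem hjM hm
  have hkIM : ∀ M, ∀ j ∈ kI M, j ∈ M := by
    intro M j hj
    have := hj.1 1
    simpa using this
  have hcovby : ∀ M ∈ CB, kI M ⋖ J := by
    intro M hM
    obtain ⟨hMC, hMJ⟩ := Finset.mem_filter.mp hM
    refine ⟨lt_of_le_of_ne inf_le_right ?_, ?_⟩
    · intro h
      apply hMJ
      intro j hj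
      rw [← h] at hj
      exact hkIM M j hj
    · intro K' h1 h2
      obtain ⟨w, hwK', hw⟩ := SetLike.exists_of_lt h1
      have hK'M : ¬ ∀ z ∈ K', z ∈ M := fun h => hw (hkI M hM w (h2.le hwK') (h w hwK'))
      apply h2.not_ge
      intro j hj
      obtain ⟨m, hm, hjm⟩ := coatom_add M (hcoat M hMC) K' hK'M j
      have hmJ : m ∈ J := by
        have := J.sub_mem hj (h2.le hjm)
        simpa using this
      have := K'.add_mem hjm (h1.le (hkI M hM m hmJ hm))
      simpa using this
  have hnK : ∀ M ∈ CB, ((∏ p ∈ s, p : ℕ) : R) ∈ kI M := by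
    intro M hM
    apply hkI M hM _ hnJ
    obtain ⟨m, hm, h1m⟩ := hCB M hM 1
    have h0 := hJ2 _ hnJ _ h1m
    have : ((∏ p ∈ s, p : ℕ) : R) = (∏ p ∈ s, p : ℕ) • m := by
      rw [nsmul_eq_mul]; linear_combination h0
    rw [this]
    exact nsmul_mem hm _
  have hcovT : ∀ j ∈ J, ∃ K ∈ CB.image kI, j ∈ K := by
    intro j hj
    obtain ⟨M, hM, hmem⟩ := hC.2 (φ x + j)
    have hMB : M ∈ CB := by
      refine Finset.mem_filter.mpr ⟨hM, fun hMJ => ?_⟩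
      apply hx M (Finset.mem_filter.mpr ⟨hM, hMJ⟩)
      have := M.sub_mem hmem (hMJ _ (J.add_mem (hφ1 x) hj))
      convert this using 1; ring
    refine ⟨kI M, Finset.mem_image_of_mem _ hMB, hkI M hMB j hj ?_⟩
    obtain ⟨m, hm, hxm⟩ := hCB M hMB x
    obtain ⟨a, ha, haj⟩ := hφ2 m _ hxm
    rw [hJ2 a ha _ hxm, add_sub_cancel, sub_eq_zero] at haj
    have h1 := M.sub_mem hmem (hφ3 M m hm)
    rw [haj] at h1
    simpa using h1
  have hTcov : ∀ K ∈ CB.image kI, K ⋖ J := by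
    intro K hK
    obtain ⟨M, hM, rfl⟩ := Finset.mem_image.mp hK
    exact hcovby M hM
  obtain ⟨P, hP, T', hT', hPT', hcovT'⟩ := select_lemma J _ hTcov hcovT
  have hcount := cover_counting P J hP T' hPT' (fun K hK => (hTcov K (hT' hK)).lt) hcovT'
  have hT'card : T'.card ≤ C.card :=
    (Finset.card_le_card hT').trans (Finset.card_image_le.trans (Finset.card_filter_le _ _))
  have hfinq : Finite (R ⧸ P) := Finite.of_surjective _ Ideal.Quotient.mk_surjective
  have hqpos : 0 < Nat.card (R ⧸ P) := Nat.card_pos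
  obtain ⟨K1, hK1, K2, hK2, hne⟩ := Finset.one_lt_card.mp (show 1 < T'.card by omega)
  have hnT : ∀ K ∈ T', ((∏ p ∈ s, p : ℕ) : R) ∈ K := by
    intro K hK
    obtain ⟨M, hM, rfl⟩ := Finset.mem_image.mp (hT' hK)
    exact hnK M hM
  obtain ⟨I, F, hF, hFf, ⟨e⟩, hFcard⟩ := main_build J hJdef P hP K1 K2 hne
    (hTcov K1 (hT' hK1)) (hTcov K2 (hT' hK2)) (hPT' K1 hK1) (hPT' K2 hK2) s hsp
    (hnT K1 hK1) (hnT K2 hK2)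
  have hlow : (Fintype.card F : ℕ∞) + 1 ≤ ringSigma R := by
    refine le_trans ?_ hcard
    rw [hFcard]
    exact_mod_cast hcount.trans hT'card
  have hIbot : I = ⊥ := by
    apply hvanish
    exact (sigma_le_of_surjective (e : R ⧸ I →+* _) e.surjective).trans
      ((sigma_tsz_le F).trans hlow)
  subst hIbot
  let e' : R ≃+* TrivSqZeroExt F (F × F) := (RingEquiv.quotientBot R).symm.trans e
  exact ⟨F, hF, hFf, ⟨e'⟩, le_antisymm
    ((sigma_le_of_surjective (e' : R →+* _) e'.surjective).trans (sigma_tsz_le F)) hlow⟩
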